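/- Let M0, N0, M1, N1, g̃2, g2, g̃3, g3 be elements of R0[X,Y] satisfying: (B1) g̃2 ∈ I and g̃3 ∈ I, g2 ∈ 2·R0[X,Y] and g3 ∈ 2·R0[X,Y], and the leading Y-coefficient of g̃3 does not lie in 4·R0[X]; (B2) the leading Y-coefficient of M0 and the leading Y-coefficient of M1 do not lie in 2·R0[X]; (B3) deg_Y(g̃2) ≤ deg_Y(M0) < deg_Y(g̃3) < deg_Y(M1). Set d0 = deg_Y(M0), d1 = deg_Y(M1), d3 = deg_Y(g̃3), and let (q0, q1, q2, q3) = G(M0 + 2·N0, M1 + 2·N1, g̃2 + 2·g2, g̃3 + 2·g3) ∈ R0[X,Y]⁴. Then every coefficient of each q_i is even, and there exist M0', N0', M1', N1', g̃2', g2', g̃3', g3' ∈ R0[X,Y] again satisfying conditions (B1), (B2) and (B3), such that q0 = 2·(M0' + 2·N0'), q1 = 2·(M1' + 2·N1'), q2 = 2·(g̃2' + 2·g2'), q3 = 2·(g̃3' + 2·g3'); moreover these can be chosen so that deg_Y(M0') = 11·d0 + 15·d1 + d3, deg_Y(M1') = 10·d0 + 17·d1, deg_Y(g̃3') = 10·d0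 + 16·d1 + d3, and deg_Y(g̃2') ≤ 11·d0 + 15·d1 + d3. In particular q0, q1 and q3 are nonzero. -/

import Mathlib

/- STATEMENT 11: Lemma 3.9 of the paper (the key inductive step).
R0 = ℤ[a2001, a1200, a1110, a1101, a0210] = MvPolynomial (Fin 5) ℤ (variables indexed
0,…,4 in that order); R0[X,Y] is realized as Polynomial (Polynomial R0), the inner
variable being X and the outer variable being Y, so that deg_Y is natDegree and the
leading Y-coefficient is leadingCoeff ∈ R0[X].  w = a2001·a0210 + a1110·a1101.
Membership in the ideal I of R0[X,Y] generated by 4 and 2w is expressed by saying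
that every R0-coefficient lies in the ideal (4, 2w) of R0.  The cubic f, the Blanc
involution tuples σ1, σ2, σ3 and the composite substitution G = σ1 ∘ σ2 ∘ σ3 are
defined below. -/

open MvPolynomial

noncomputable section

variable {A : Type} [CommRing A]

/-- The cubic form f = a2001·x0²x3 + a1200·x0x1² + a1110·x0x1x2 + a1101·x0x1x3 + a0210·x1²x2,
with coefficients a = (a2001, a1200, a1110, a1101, a0210) : Fin 5 → A. -/
def cub (a : Fin 5 → A) : MvPolynomial (Fin 4) A :=
  C (a 0) * X 0 ^ 2 * X 3 + C (a 1) * X 0 * X 1 ^ 2 + C (a 2) * X 0 * X 1 * X 2 +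
    C (a 3) * X 0 * X 1 * X 3 + C (a 4) * X 1 ^ 2 * X 2

/-- The Blanc involution tuple σ1 = (x0·∂f/∂x1, x1·∂f/∂x1 − 2f, x2·∂f/∂x1, x3·∂f/∂x1). -/
def sig1 (a : Fin 5 → A) : Fin 4 → MvPolynomial (Fin 4) A :=
  ![X 0 * pderiv 1 (cub a), X 1 * pderiv 1 (cub a) - 2 * cub a,
    X 2 * pderiv 1 (cub a), X 3 * pderiv 1 (cub a)]

/-- The Blanc involution tuple σ2. -/
def sig2 (a : Fin 5 → A) : Fin 4 → MvPolynomial (Fin 4) A :=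
  ![X 0 * pderiv 2 (cub a), X 1 * pderiv 2 (cub a),
    X 2 * pderiv 2 (cub a) - 2 * cub a, X 3 * pderiv 2 (cub a)]

/-- The Blanc involution tuple σ3. -/
def sig3 (a : Fin 5 → A) : Fin 4 → MvPolynomial (Fin 4) A :=
  ![X 0 * pderiv 3 (cub a), X 1 * pderiv 3 (cub a),
    X 2 * pderiv 3 (cub a), X 3 * pderiv 3 (cub a) - 2 * cub a]

/-- G(v) = σ1(σ2(σ3(v))): substitute v into σ3, the result into σ2, that into σ1. -/
def Gmap (a : Fin 5 → A) (v : Fin 4 → A) : Fin 4 → A :=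
  fun i => eval (fun j => eval (fun k => eval v (sig3 a k)) (sig2 a j)) (sig1 a i)

abbrev R₀ : Type := MvPolynomial (Fin 5) ℤ

/-- R0[X,Y], inner variable X, outer variable Y. -/
abbrev A₁₁ : Type := Polynomial (Polynomial R₀)

/-- The coefficients a2001, …, a0210 of R0, viewed as constants in R0[X,Y]. -/
noncomputable def aC : Fin 5 → A₁₁ :=
  fun i => Polynomial.C (Polynomial.C (MvPolynomial.X i))

/-- w = a2001·a0210 + a1110·a1101. -/
noncomputable def wEl : R₀ :=
  MvPolynomial.X 0 * MvPolynomial.X 4 + MvPolynomial.X 2 * MvPolynomial.X 3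

/-- The ideal (4, 2w) of R0. -/
noncomputable def Jideal : Ideal R₀ := Ideal.span {(4 : R₀), 2 * wEl}

/-- Membership in the ideal I of R0[X,Y]: every R0-coefficient lies in (4, 2w). -/
def memI (P : A₁₁) : Prop := ∀ n m : ℕ, ((P.coeff n).coeff m) ∈ Jideal

set_option maxSynthPendingDepth 5

lemma Gmap_eq {A : Type} [CommRing A] (a : Fin 5 → A) (m n s t : A) :
    ∀ u v p h z0 z1 z2 z3 F : A, u = a 0 * m + a 3 * n → v = a 2 * m + a 4 * n → p = m * u →
    h = a 1 * m * n ^ 2 + 2 * s * n * v → z0 = m * n * v * p ^ 3 → z1 = n ^ 2 * v * p ^ 3 →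
    z2 = p ^ 3 * (-(s * n * v) - (a 1 * m * n ^ 2 - 2 * t * p - 2 * h)) →
    z3 = p ^ 2 * n * v * (-(t * p) - h) →
    F = a 1 * z0 * z1 + z0 * (a 2 * z2 + a 3 * z3) + 2 * a 4 * z1 * z2 →
    Gmap a ![m, n, 2 * s, 2 * t] 0 = 2 * (z0 * F) ∧
    Gmap a ![m, n, 2 * s, 2 * t] 1 =
      2 * (-(z1 * z0 * (a 2 * z2 + a 3 * z3)) - 2 * a 0 * z0 ^ 2 * z3) ∧
    Gmap a ![m, n, 2 * s, 2 * t] 2 = 2 * (2 * (z2 * F)) ∧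
    Gmap a ![m, n, 2 * s, 2 * t] 3 = 2 * (2 * (z3 * F)) := by
  intro u v p h z0 z1 z2 z3 F hu hv hp hh h0 h1 h2 h3 hF
  have e3 : (fun k => eval ![m, n, 2 * s, 2 * t] (sig3 a k)) =
      ![m * p, n * p, 2 * s * p, 2 * (-(t * p) - h)] := by
    subst hh hp hu hv
    funext k
    fin_cases k <;>
      simp [sig3, cub, pderiv_X, Derivation.leibniz_pow] <;> ring
  have e2 : (fun j => eval ![m * p, n * p, 2 * s * p, 2 * (-(t * p) - h)] (sig2 a j)) =
      ![z0, z1, 2 * z2, 2 * z3] := by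
    subst h0 h1 h2 h3
    funext k
    fin_cases k <;>
      simp [sig2, cub, pderiv_X, Derivation.leibniz_pow]
    · subst hv; ring
    · subst hv; ring
    · have : p = m * (a 0 * m + a 3 * n) := by rw [hp, hu]
      subst hv
      linear_combination (-(4 * p ^ 2) * (-(t * p) - h)) * (-this)
    · subst hv; ring
  simp only [Gmap, e3, e2]
  subst hF
  refine ⟨?_, ?_, ?_, ?_⟩ <;>
      simp [sig1, cub, pderiv_X, Derivation.leibniz_pow] <;> ring

/-- nonzero of exact degree -/
def DD {B : Type} [CommRing B] (P : Polynomial B) (n : ℕ) : Prop := P ≠ 0 ∧ P.natDegree = n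

section deg
variable {B : Type} [CommRing B] [IsDomain B]

lemma DD.mul {P Q : Polynomial B} {i j : ℕ} (h : DD P i) (k : DD Q j) : DD (P * Q) (i + j) :=
  ⟨mul_ne_zero h.1 k.1, by rw [Polynomial.natDegree_mul h.1 k.1, h.2, k.2]⟩

lemma DD.pow {P : Polynomial B} {i : ℕ} (h : DD P i) (k : ℕ) : DD (P ^ k) (k * i) :=
  ⟨pow_ne_zero _ h.1, by rw [Polynomial.natDegree_pow, h.2]⟩

lemma DD.add_lt {P Q : Polynomial B} {i : ℕ} (h : DD P i) (k : Q.natDegree < i) :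
    DD (Q + P) i := by
  have h2 : (Q + P).natDegree = i := by
    rw [Polynomial.natDegree_add_eq_right_of_natDegree_lt (by rw [h.2]; exact k), h.2]
  refine ⟨?_, h2⟩
  intro h0
  rw [h0] at h2
  simp at h2
  omega

lemma DD.C {x : B} (h : x ≠ 0) : DD (Polynomial.C x) 0 := ⟨by simpa using h, by simp⟩

lemma deg_main (a b c d e w : B) (hb : b ≠ 0) (hd : d ≠ 0) (he : e ≠ 0)
    (hw : w ≠ 0) (m n S T : Polynomial B) (i j k : ℕ) (hm : DD m i) (hn : DD n j) (hT : DD T k)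
    (hS : S.natDegree ≤ i) (hik : i < k) (hkj : k < j) :
    ∀ u v p h z0 z1 z2 z3 E : Polynomial B,
    u = Polynomial.C a * m + Polynomial.C d * n →
    v = Polynomial.C c * m + Polynomial.C e * n → p = m * u →
    h = Polynomial.C b * m * n ^ 2 → z0 = m * n * v * p ^ 3 → z1 = n ^ 2 * v * p ^ 3 →
    z2 = p ^ 3 * (Polynomial.C w * S * n * v + h) →
    z3 = p ^ 2 * n * v * (Polynomial.C w * T * p + h) →
    E = z0 * p ^ 2 * n * (Polynomial.C b * m ^ 2 * n ^ 2 +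
      p * v * (Polynomial.C c * S + Polynomial.C d * T)) →
    DD (z0 * (Polynomial.C w * E)) (11 * i + 15 * j + k) ∧
    DD (z1 * z0 * (p ^ 2 * n * (p * v * (Polynomial.C c * (Polynomial.C w * S) +
       Polynomial.C d * (Polynomial.C w * T)) +
       Polynomial.C b * m * n * (Polynomial.C c * p + Polynomial.C d * n * v))))
       (10 * i + 17 * j) ∧
    (z2 * E).natDegree ≤ 11 * i + 15 * j + k ∧
    DD (z3 * E) (10 * i + 16 * j + k) := by
  intro u v p h z0 z1 z2 z3 E hu hv hp hh h0 h1 h2 h3 hE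
  have cl : ∀ (x : B) (P : Polynomial B), (Polynomial.C x * P).natDegree ≤ P.natDegree :=
    fun x P => Polynomial.natDegree_C_mul_le x P
  have ml : ∀ (P Q : Polynomial B), (P * Q).natDegree ≤ P.natDegree + Q.natDegree :=
    fun P Q => Polynomial.natDegree_mul_le
  have Du : DD u j := by
    rw [hu]
    have := ((DD.C hd).mul hn)
    rw [zero_add] at this
    exact this.add_lt (by have := cl a m; rw [hm.2] at this; omega)
  have Dv : DD v j := by
    rw [hv]
    have := ((DD.C he).mul hn)
    rw [zero_add] at this
    exact this.add_lt (by have := cl c m; rw [hm.2] at this; omega)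
  have Dp : DD p (i + j) := by rw [hp]; exact hm.mul Du
  have Dh : DD h (0 + i + 2 * j) := by rw [hh]; exact ((DD.C hb).mul hm).mul (hn.pow 2)
  have Dz0 : DD z0 (i + j + j + 3 * (i + j)) := by
    rw [h0]; exact ((hm.mul hn).mul Dv).mul (Dp.pow 3)
  have Dz1 : DD z1 (2 * j + j + 3 * (i + j)) := by
    rw [h1]; exact ((hn.pow 2).mul Dv).mul (Dp.pow 3)
  have Dwt : DD (Polynomial.C w * T * p) (0 + k + (i + j)) := ((DD.C hw).mul hT).mul Dp
  have Dz3 : DD z3 (2 * (i + j) + j + j + (0 + i + 2 * j)) := by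
    rw [h3]
    exact (((Dp.pow 2).mul hn).mul Dv).mul (Dh.add_lt (by rw [Dwt.2]; omega))
  have Dst : DD (Polynomial.C c * S + Polynomial.C d * T) (0 + k) :=
    ((DD.C hd).mul hT).add_lt (by have := cl c S; omega)
  have Dbr : DD (Polynomial.C b * m ^ 2 * n ^ 2 +
      p * v * (Polynomial.C c * S + Polynomial.C d * T)) (i + j + j + (0 + k)) := by
    refine ((Dp.mul Dv).mul Dst).add_lt ?_
    rw [(((DD.C hb).mul (hm.pow 2)).mul (hn.pow 2)).2]; omega
  have DE := ((Dz0.mul (Dp.pow 2)).mul hn).mul Dbr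
  rw [← hE] at DE
  refine ⟨?_, ?_, ?_, ?_⟩
  · have := Dz0.mul ((DD.C hw).mul DE)
    exact ⟨this.1, by rw [this.2]; ring⟩
  · have e1 : DD (Polynomial.C c * p + Polynomial.C d * n * v) (0 + j + j) :=
      (((DD.C hd).mul hn).mul Dv).add_lt (by have := cl c p; rw [Dp.2] at this; omega)
    have e2 := (((DD.C hb).mul hm).mul hn).mul e1
    have e3 : DD (Polynomial.C c * (Polynomial.C w * S) +
       Polynomial.C d * (Polynomial.C w * T)) (0 + (0 + k)) :=
      ((DD.C hd).mul ((DD.C hw).mul hT)).add_lt (by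
        have := cl c (Polynomial.C w * S); have := cl w S; omega)
    have e4 := (Dp.mul Dv).mul e3
    have e5 := (Dz1.mul Dz0).mul (((Dp.pow 2).mul hn).mul (e2.add_lt (by rw [e4.2]; omega)))
    exact ⟨e5.1, by rw [e5.2]; ring⟩
  · have e1 : (Polynomial.C w * S * n * v + h).natDegree ≤ i + 2 * j := by
      refine (Polynomial.natDegree_add_le _ _).trans (max_le ?_ (by rw [Dh.2]; omega))
      have h1 := ml (Polynomial.C w * S * n) v
      have h2 := ml (Polynomial.C w * S) n
      have h3 := cl w S
      have h4 := Dv.2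
      have h5 := hn.2
      omega
    have e2 := ml z2 E
    have e3 : z2.natDegree ≤ 3 * (i + j) + (i + 2 * j) := by
      rw [h2]
      refine (ml _ _).trans ?_
      rw [(Dp.pow 3).2]
      omega
    rw [DE.2] at e2
    omega
  · have := Dz3.mul DE
    exact ⟨this.1, by rw [this.2]; ring⟩

end deg

/-- The field with two elements, with its structure sealed. -/
def K2 : Type := ZMod 2
instance : CommRing K2 := inferInstanceAs (CommRing (ZMod 2))
instance : IsDomain K2 := inferInstanceAs (IsDomain (ZMod 2))

abbrev S₂ : Type := MvPolynomial (Fin 5) K2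


def redR : R₀ →+* S₂ := MvPolynomial.map (Int.castRingHom K2)
def redX : Polynomial R₀ →+* Polynomial S₂ := Polynomial.mapRingHom redR
def redY : A₁₁ →+* Polynomial (Polynomial S₂) := Polynomial.mapRingHom redX

lemma redR_surj : Function.Surjective redR :=
  MvPolynomial.map_surjective _ (ZMod.ringHom_surjective (n := 2) _)
lemma redX_surj : Function.Surjective redX := Polynomial.map_surjective _ redR_surj

lemma dvd_coeff {R : Type} [CommRing R] (P : Polynomial R) :
    (2 : Polynomial R) ∣ P ↔ ∀ n, (2 : R) ∣ P.coeff n := by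
  have := Polynomial.C_dvd_iff_dvd_coeff (2 : R) P
  have h2 : (Polynomial.C (2 : R) : Polynomial R) = 2 := map_ofNat Polynomial.C 2
  rwa [h2] at this

lemma redR_zero (x : R₀) : redR x = 0 ↔ (2 : R₀) ∣ x := by
  have h := MvPolynomial.C_dvd_iff_map_hom_eq_zero (Int.castRingHom K2) 2
    (fun r => by
      have := ZMod.intCast_zmod_eq_zero_iff_dvd r 2
      exact this) x
  have h2 : (MvPolynomial.C (2 : ℤ) : R₀) = 2 := by simp
  rw [h2] at h
  exact h.symm

lemma redX_zero (x : Polynomial R₀) : redX x = 0 ↔ (2 : Polynomial R₀) ∣ x := by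
  rw [dvd_coeff, Polynomial.ext_iff]
  refine forall_congr' fun n => ?_
  rw [← redR_zero]
  simp [redX]

lemma redY_zero (x : A₁₁) : redY x = 0 ↔ (2 : A₁₁) ∣ x := by
  rw [dvd_coeff, Polynomial.ext_iff]
  refine forall_congr' fun n => ?_
  rw [← redX_zero]
  simp [redY]

lemma redY_two : redY 2 = 0 := (redY_zero 2).2 dvd_rfl

lemma red_DD (P : A₁₁) (h : ¬ (2 : Polynomial R₀) ∣ P.leadingCoeff) :
    DD (redY P) P.natDegree := by
  rw [← redX_zero] at h
  refine ⟨?_, Polynomial.natDegree_map_of_leadingCoeff_ne_zero _ h⟩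
  intro h0
  apply h
  have : (redY P).coeff P.natDegree = 0 := by rw [h0]; simp
  simpa [redY] using this

lemma lift_le (Q : Polynomial (Polynomial S₂)) :
    ∃ P : A₁₁, redY P = Q ∧ P.natDegree = Q.natDegree := by
  have h : Q ∈ Polynomial.lifts redX := by
    rw [Polynomial.lifts_iff_coeff_lifts]
    intro n
    exact redX_surj _
  obtain ⟨P, h1, h2⟩ := Polynomial.exists_degree_eq_of_mem_lifts h
  exact ⟨P, h1, Polynomial.natDegree_eq_of_degree_eq h2⟩

lemma lift_lc (P : A₁₁) (n : ℕ) (h : DD (redY P) n) (hn : P.natDegree = (redY P).natDegree) :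
    ¬ (2 : Polynomial R₀) ∣ P.leadingCoeff := by
  rw [← redX_zero]
  have : redX P.leadingCoeff = (redY P).leadingCoeff := by
    rw [Polynomial.leadingCoeff, Polynomial.leadingCoeff, ← hn]; simp [redY]
  rw [this]
  simpa using h.1

lemma eq_add_two (Q P : A₁₁) (h : redY P = redY Q) : ∃ N, Q = P + 2 * N := by
  have : redY (Q - P) = 0 := by rw [redY.map_sub, h, sub_self]
  obtain ⟨N, hN⟩ := (redY_zero _).1 this
  exact ⟨N, by rw [← hN]; ring⟩

abbrev wC : A₁₁ := Polynomial.C (Polynomial.C wEl)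

lemma memI_iff (P : A₁₁) : memI P ↔ ∃ P1 P2 : A₁₁, P = 2 * (wC * P2 + 2 * P1) := by
  have h1 : memI P ↔ P ∈ Ideal.map Polynomial.C (Ideal.map Polynomial.C Jideal) := by
    simp only [Ideal.mem_map_C_iff, memI]
  rw [h1, Jideal, Ideal.map_span, Ideal.map_span, Set.image_pair, Set.image_pair,
    Ideal.mem_span_pair]
  have h2 : (Polynomial.C (Polynomial.C (2 : R₀)) : A₁₁) = 2 := by
    rw [map_ofNat Polynomial.C 2]; exact map_ofNat Polynomial.C 2
  have h4 : (Polynomial.C (Polynomial.C (4 : R₀)) : A₁₁) = 4 := by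
    rw [map_ofNat Polynomial.C 4]; exact map_ofNat Polynomial.C 4
  constructor
  · rintro ⟨x, y, h⟩
    refine ⟨x, y, ?_⟩
    rw [← h]
    rw [h4, Polynomial.C_mul, Polynomial.C_mul, h2]
    ring
  · rintro ⟨x, y, h⟩
    refine ⟨x, y, ?_⟩
    rw [h]
    rw [h4, Polynomial.C_mul, Polynomial.C_mul, h2]
    ring

lemma two_ne : (2 : Polynomial R₀) ≠ 0 := by norm_num

lemma natDegree_two_mul (P : A₁₁) : (2 * P).natDegree = P.natDegree :=
  Polynomial.natDegree_C_mul two_ne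

lemma lc_two_mul (P : A₁₁) : (2 * P).leadingCoeff = 2 * P.leadingCoeff := by
  rw [Polynomial.leadingCoeff_mul]
  congr 1
  exact Polynomial.leadingCoeff_C (2 : Polynomial R₀)

lemma four_dvd (x : Polynomial R₀) : (4 : Polynomial R₀) ∣ 2 * x ↔ (2 : Polynomial R₀) ∣ x := by
  have : (4 : Polynomial R₀) = 2 * 2 := by norm_num
  rw [this, mul_dvd_mul_iff_left two_ne]

lemma redR_w_ne : redR wEl ≠ 0 := by
  intro h
  have := congrArg (MvPolynomial.eval (fun i : Fin 5 => if i = 0 ∨ i = 4 then (1 : K2) else 0)) h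
  simp [redR, wEl] at this

theorem stmt_11
    (M0 N0 M1 N1 gt2 g2 gt3 g3 : A₁₁)
    -- (B1)
    (hB1a : memI gt2) (hB1b : memI gt3)
    (hB1c : (2 : A₁₁) ∣ g2) (hB1d : (2 : A₁₁) ∣ g3)
    (hB1e : ¬ ((4 : Polynomial R₀) ∣ gt3.leadingCoeff))
    -- (B2)
    (hB2a : ¬ ((2 : Polynomial R₀) ∣ M0.leadingCoeff))
    (hB2b : ¬ ((2 : Polynomial R₀) ∣ M1.leadingCoeff))
    -- (B3)
    (hB3a : gt2.natDegree ≤ M0.natDegree)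
    (hB3b : M0.natDegree < gt3.natDegree)
    (hB3c : gt3.natDegree < M1.natDegree)
    (q : Fin 4 → A₁₁)
    (hq : q = Gmap aC ![M0 + 2 * N0, M1 + 2 * N1, gt2 + 2 * g2, gt3 + 2 * g3]) :
    (∀ (i : Fin 4) (n m : ℕ), (2 : R₀) ∣ (((q i).coeff n).coeff m)) ∧
    ∃ M0' N0' M1' N1' gt2' g2' gt3' g3' : A₁₁,
      -- (B1) for the new polynomials
      (memI gt2' ∧ memI gt3' ∧ (2 : A₁₁) ∣ g2' ∧ (2 : A₁₁) ∣ g3' ∧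
        ¬ ((4 : Polynomial R₀) ∣ gt3'.leadingCoeff)) ∧
      -- (B2) for the new polynomials
      (¬ ((2 : Polynomial R₀) ∣ M0'.leadingCoeff) ∧
        ¬ ((2 : Polynomial R₀) ∣ M1'.leadingCoeff)) ∧
      -- (B3) for the new polynomials
      (gt2'.natDegree ≤ M0'.natDegree ∧ M0'.natDegree < gt3'.natDegree ∧
        gt3'.natDegree < M1'.natDegree) ∧
      q 0 = 2 * (M0' + 2 * N0') ∧
      q 1 = 2 * (M1' + 2 * N1') ∧
      q 2 = 2 * (gt2' + 2 * g2') ∧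
      q 3 = 2 * (gt3' + 2 * g3') ∧
      M0'.natDegree = 11 * M0.natDegree + 15 * M1.natDegree + gt3.natDegree ∧
      M1'.natDegree = 10 * M0.natDegree + 17 * M1.natDegree ∧
      gt3'.natDegree = 10 * M0.natDegree + 16 * M1.natDegree + gt3.natDegree ∧
      gt2'.natDegree ≤ 11 * M0.natDegree + 15 * M1.natDegree + gt3.natDegree ∧
      q 0 ≠ 0 ∧ q 1 ≠ 0 ∧ q 3 ≠ 0 := by
  obtain ⟨P1, S, hS⟩ := (memI_iff gt2).1 hB1a
  obtain ⟨T1, T, hT⟩ := (memI_iff gt3).1 hB1b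
  obtain ⟨G2, hG2⟩ := hB1c
  obtain ⟨G3, hG3⟩ := hB1d
  obtain ⟨m, hm⟩ : ∃ x, x = M0 + 2 * N0 := ⟨_, rfl⟩
  obtain ⟨n, hn⟩ : ∃ x, x = M1 + 2 * N1 := ⟨_, rfl⟩
  obtain ⟨s, hs⟩ : ∃ x, x = wC * S + 2 * (P1 + G2) := ⟨_, rfl⟩
  obtain ⟨t, ht⟩ : ∃ x, x = wC * T + 2 * (T1 + G3) := ⟨_, rfl⟩
  have hs2 : gt2 + 2 * g2 = 2 * s := by rw [hs, hG2, hS]; ring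
  have ht2 : gt3 + 2 * g3 = 2 * t := by rw [ht, hG3, hT]; ring
  rw [hs2, ht2, ← hm, ← hn] at hq
  obtain ⟨u, hu⟩ : ∃ x, x = aC 0 * m + aC 3 * n := ⟨_, rfl⟩
  obtain ⟨v, hv⟩ : ∃ x, x = aC 2 * m + aC 4 * n := ⟨_, rfl⟩
  obtain ⟨p, hp⟩ : ∃ x, x = m * u := ⟨_, rfl⟩
  obtain ⟨h, hh⟩ : ∃ x, x = aC 1 * m * n ^ 2 + 2 * s * n * v := ⟨_, rfl⟩
  obtain ⟨z0, h0⟩ : ∃ x, x = m * n * v * p ^ 3 := ⟨_, rfl⟩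
  obtain ⟨z1, h1⟩ : ∃ x, x = n ^ 2 * v * p ^ 3 := ⟨_, rfl⟩
  obtain ⟨z2, h2⟩ : ∃ x, x = p ^ 3 * (-(s * n * v) - (aC 1 * m * n ^ 2 - 2 * t * p - 2 * h)) :=
    ⟨_, rfl⟩
  obtain ⟨z3, h3⟩ : ∃ x, x = p ^ 2 * n * v * (-(t * p) - h) := ⟨_, rfl⟩
  obtain ⟨F, hF⟩ : ∃ x, x = aC 1 * z0 * z1 + z0 * (aC 2 * z2 + aC 3 * z3) + 2 * aC 4 * z1 * z2 :=
    ⟨_, rfl⟩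
  obtain ⟨q0, q1, q2, q3⟩ := Gmap_eq aC m n s t u v p h z0 z1 z2 z3 F hu hv hp hh h0 h1 h2 h3 hF
  rw [← hq] at q0 q1 q2 q3
  obtain ⟨Q1, hQ1⟩ : ∃ x, x = -(z1 * z0 * (aC 2 * z2 + aC 3 * z3)) - 2 * aC 0 * z0 ^ 2 * z3 :=
    ⟨_, rfl⟩
  rw [← hQ1] at q1
  -- reductions
  have hK : (2 : Polynomial (Polynomial S₂)) = 0 := by
    have := redY_two
    rwa [map_ofNat redY 2] at this
  have rm : redY m = redY M0 := by rw [hm, redY.map_add, redY.map_mul, redY_two]; ring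
  have rn : redY n = redY M1 := by rw [hn, redY.map_add, redY.map_mul, redY_two]; ring
  have rw' : redY wC = Polynomial.C (Polynomial.C (redR wEl)) := by simp [redY, redX, wC]
  have ra : ∀ i, redY (aC i) = Polynomial.C (Polynomial.C (MvPolynomial.X i)) := by
    intro i; simp [redY, redX, redR, aC]
  have rs : redY s = Polynomial.C (Polynomial.C (redR wEl)) * redY S := by
    rw [hs, redY.map_add, redY.map_mul, redY.map_mul, redY_two, rw']; ring
  have rt : redY t = Polynomial.C (Polynomial.C (redR wEl)) * redY T := by
    rw [ht, redY.map_add, redY.map_mul, redY.map_mul, redY_two, rw']; ring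
  have hwne : (Polynomial.C (redR wEl) : Polynomial S₂) ≠ 0 := by
    simpa using redR_w_ne
  have hXne : ∀ i, (Polynomial.C (MvPolynomial.X i) : Polynomial S₂) ≠ 0 := by
    intro i; simpa using MvPolynomial.X_ne_zero i
  have Dm := red_DD M0 hB2a
  have Dn := red_DD M1 hB2b
  have DT : DD (redY T) gt3.natDegree := by
    rw [hT, lc_two_mul, four_dvd] at hB1e
    have := red_DD _ hB1e
    rw [redY.map_add, redY.map_mul, redY.map_mul, redY_two, rw', zero_mul, add_zero] at this
    refine ⟨right_ne_zero_of_mul this.1, ?_⟩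
    rw [hT, natDegree_two_mul, ← this.2, Polynomial.natDegree_C_mul hwne]
  have DS : (redY S).natDegree ≤ M0.natDegree := by
    refine le_trans ?_ hB3a
    have h1 : (redY (wC * S + 2 * P1)).natDegree ≤ (wC * S + 2 * P1).natDegree :=
      Polynomial.natDegree_map_le
    rw [redY.map_add, redY.map_mul, redY.map_mul, redY_two, rw', zero_mul, add_zero,
      Polynomial.natDegree_C_mul hwne] at h1
    rwa [hS, natDegree_two_mul]
  have ru := congrArg redY hu
  have rv := congrArg redY hv
  have rp := congrArg redY hp
  have rh := congrArg redY hh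
  have r0 := congrArg redY h0
  have r1 := congrArg redY h1
  have r2 := congrArg redY h2
  have r3 := congrArg redY h3
  have rF := congrArg redY hF
  have rQ1 := congrArg redY hQ1
  simp only [redY.map_add, redY.map_mul, redY.map_sub, redY.map_neg, redY.map_pow, redY_two,
    rm, rn, ra, rs, rt] at ru rv rp rh r0 r1 r2 r3 rF rQ1
  have hwq : Polynomial.C (Polynomial.C (redR wEl)) =
      (Polynomial.C (Polynomial.C (MvPolynomial.X 0)) *
      Polynomial.C (Polynomial.C (MvPolynomial.X 4)) +
      Polynomial.C (Polynomial.C (MvPolynomial.X 2)) *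
      Polynomial.C (Polynomial.C (MvPolynomial.X 3)) : Polynomial (Polynomial S₂)) := by
    simp [redR, wEl]
  obtain ⟨E, hE⟩ : ∃ x, x = redY z0 * redY p ^ 2 * redY M1 *
      (Polynomial.C (Polynomial.C (MvPolynomial.X 1)) * redY M0 ^ 2 * redY M1 ^ 2 +
      redY p * redY v * (Polynomial.C (Polynomial.C (MvPolynomial.X 2)) * redY S +
        Polynomial.C (Polynomial.C (MvPolynomial.X 3)) * redY T)) := ⟨_, rfl⟩
  have rh' : redY h = Polynomial.C (Polynomial.C (MvPolynomial.X 1)) * redY M0 * redY M1 ^ 2 := by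
    rw [rh]; ring
  have r2' : redY z2 = redY p ^ 3 *
      (Polynomial.C (Polynomial.C (redR wEl)) * redY S * redY M1 * redY v + redY h) := by
    rw [r2, rh']
    linear_combination (-redY p ^ 3 *
      (Polynomial.C (Polynomial.C (redR wEl)) * redY S * redY M1 * redY v +
      Polynomial.C (Polynomial.C (MvPolynomial.X 1)) * redY M0 * redY M1 ^ 2)) * hK
  have r3' : redY z3 = redY p ^ 2 * redY M1 * redY v *
      (Polynomial.C (Polynomial.C (redR wEl)) * redY T * redY p + redY h) := by
    rw [r3]
    linear_combination (-redY p ^ 2 * redY M1 * redY v *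
      (Polynomial.C (Polynomial.C (redR wEl)) * redY T * redY p + redY h)) * hK
  obtain ⟨D0, D1, D2, D3⟩ := deg_main _ _ _ _ _ _ (hXne 1) (hXne 3) (hXne 4) hwne
    (redY M0) (redY M1) (redY S) (redY T) _ _ _ Dm Dn DT DS hB3b hB3c _ _ _ _ _ _ _ _ E
    ru rv rp rh' r0 r1 r2' r3' hE
  have rF' : redY F = Polynomial.C (Polynomial.C (redR wEl)) * E := by
    rw [rF, hE, r1, r2', r3', rh']
    generalize redY z0 = Z
    rw [rp, ru, rv, hwq]
    generalize (Polynomial.C (Polynomial.C (MvPolynomial.X 0)) : Polynomial (Polynomial S₂)) = a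
    generalize (Polynomial.C (Polynomial.C (MvPolynomial.X 1)) : Polynomial (Polynomial S₂)) = b
    generalize (Polynomial.C (Polynomial.C (MvPolynomial.X 2)) : Polynomial (Polynomial S₂)) = c
    generalize (Polynomial.C (Polynomial.C (MvPolynomial.X 3)) : Polynomial (Polynomial S₂)) = d
    generalize (Polynomial.C (Polynomial.C (MvPolynomial.X 4)) : Polynomial (Polynomial S₂)) = e
    generalize redY M0 = x
    generalize redY M1 = y
    generalize redY S = S'
    generalize redY T = T'
    linear_combination (Z * (x * (a * x + d * y)) ^ 2 * (b * c * x * y ^ 2 *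
      (x * (a * x + d * y)) + b * y ^ 4 * d * e * x)) * hK
  have rQ' : redY Q1 = redY z1 * redY z0 * (redY p ^ 2 * redY M1 * (redY p * redY v *
      (Polynomial.C (Polynomial.C (MvPolynomial.X 2)) *
        (Polynomial.C (Polynomial.C (redR wEl)) * redY S) +
       Polynomial.C (Polynomial.C (MvPolynomial.X 3)) *
        (Polynomial.C (Polynomial.C (redR wEl)) * redY T)) +
       Polynomial.C (Polynomial.C (MvPolynomial.X 1)) * redY M0 * redY M1 *
        (Polynomial.C (Polynomial.C (MvPolynomial.X 2)) * redY p +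
         Polynomial.C (Polynomial.C (MvPolynomial.X 3)) * redY M1 * redY v))) := by
    rw [rQ1]
    linear_combination (-(redY z1 * redY z0 *
      (Polynomial.C (Polynomial.C (MvPolynomial.X 2)) * redY z2 +
        Polynomial.C (Polynomial.C (MvPolynomial.X 3)) * redY z3))) * hK +
      redY z1 * redY z0 * (Polynomial.C (Polynomial.C (MvPolynomial.X 2)) * (r2'.trans (by rw [rh']))
      + Polynomial.C (Polynomial.C (MvPolynomial.X 3)) * (r3'.trans (by rw [rh'])))
  rw [← rF', ← redY.map_mul] at D0
  rw [← rQ'] at D1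
  obtain ⟨M0', e0, d0⟩ := lift_le (redY (z0 * F))
  obtain ⟨M1', e1, d1⟩ := lift_le (redY Q1)
  obtain ⟨L2, e2, d2⟩ := lift_le (redY z2 * E)
  obtain ⟨L3, e3, d3⟩ := lift_le (redY z3 * E)
  obtain ⟨N0', hN0⟩ := eq_add_two _ _ e0
  obtain ⟨N1', hN1⟩ := eq_add_two _ _ e1
  obtain ⟨N2, hN2⟩ := eq_add_two (z2 * F) (wC * L2) (by
    rw [redY.map_mul, redY.map_mul, e2, rF', rw']; ring)
  obtain ⟨N3, hN3⟩ := eq_add_two (z3 * F) (wC * L3) (by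
    rw [redY.map_mul, redY.map_mul, e3, rF', rw']; ring)
  have hw0 : (Polynomial.C wEl : Polynomial R₀) ≠ 0 := by
    intro h0
    apply redR_w_ne
    rw [Polynomial.C_eq_zero.1 h0, map_zero]
  have dg2 : (2 * (wC * L2)).natDegree = (redY z2 * E).natDegree := by
    rw [natDegree_two_mul, Polynomial.natDegree_C_mul hw0, d2]
  have dg3 : (2 * (wC * L3)).natDegree = (redY z3 * E).natDegree := by
    rw [natDegree_two_mul, Polynomial.natDegree_C_mul hw0, d3]
  rw [D3.2] at dg3
  have hd0 : M0'.natDegree = _ := d0.trans D0.2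
  have hd1 : M1'.natDegree = _ := d1.trans D1.2
  have h2A : (2 : A₁₁) ≠ 0 := by norm_num
  have hq3 : z3 * F ≠ 0 := by
    intro h
    have : redY (z3 * F) = 0 := by rw [h, redY.map_zero]
    rw [redY.map_mul, rF'] at this
    have h5 : Polynomial.C (Polynomial.C (redR wEl)) * (redY z3 * E) = 0 := by
      rw [← this]; ring
    rcases mul_eq_zero.1 h5 with h6 | h6
    · exact hwne (Polynomial.C_eq_zero.1 h6)
    · exact D3.1 h6
  refine ⟨?_, M0', N0', M1', N1', 2 * (wC * L2), 2 * N2, 2 * (wC * L3), 2 * N3,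
    ⟨?_, ?_, dvd_mul_right _ _, dvd_mul_right _ _, ?_⟩, ⟨?_, ?_⟩, ⟨?_, ?_, ?_⟩, ?_, ?_, ?_, ?_,
    hd0, hd1, dg3, ?_, ?_, ?_, ?_⟩
  · intro i k l
    have : (2 : A₁₁) ∣ q i := by
      fin_cases i
      · exact ⟨_, q0⟩
      · exact ⟨_, q1⟩
      · exact ⟨_, q2⟩
      · exact ⟨_, q3⟩
    exact (dvd_coeff _).1 ((dvd_coeff _).1 this k) l
  · exact (memI_iff _).2 ⟨0, L2, by ring⟩
  · exact (memI_iff _).2 ⟨0, L3, by ring⟩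
  · rw [lc_two_mul, four_dvd]
    have e : redY (wC * L3) = Polynomial.C (Polynomial.C (redR wEl)) * (redY z3 * E) := by
      rw [redY.map_mul, e3, rw']
    refine lift_lc _ _ (e ▸ (DD.C hwne).mul D3) ?_
    rw [e, Polynomial.natDegree_C_mul hw0, Polynomial.natDegree_C_mul hwne, d3]
  · exact lift_lc _ _ (e0 ▸ D0) (by rw [e0, d0])
  · exact lift_lc _ _ (e1 ▸ D1) (by rw [e1, d1])
  · omega
  · omega
  · omega
  · rw [q0, hN0]
  · rw [q1, hN1]
  · rw [q2, hN2]; ring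
  · rw [q3, hN3]; ring
  · omega
  · rw [q0]
    exact mul_ne_zero h2A fun h => D0.1 (by rw [h, redY.map_zero])
  · rw [q1]
    exact mul_ne_zero h2A fun h => D1.1 (by rw [h, redY.map_zero])
  · rw [q3]
    exact mul_ne_zero h2A (mul_ne_zero h2A hq3)
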